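/- arXiv:1803.04138 — 2 statements merged into one kernel-verified Lean document; each statement's English description precedes it below -/
import Mathlib

section
/- Let n ≥ 1, let f be a simple aggregation function on n agents, and let agent i ∈ {1,...,n} be a dictator in f. Then φ_i(f) = 1. -/
open MeasureTheory

noncomputable section

/-- The unit cube `[0,1]^n`. -/
def cube (n : ℕ) : Set (Fin n → ℝ) := Set.Icc 0 1

/-- A simple aggregation function on `n` agents: a map `[0,1]^n → [0,1]` that is
surjective (onto `[0,1]`), continuous, and weakly monotonic increasing. -/
def IsSimpleAgg (n : ℕ) (f : (Fin n → ℝ) → ℝ) : Prop :=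
  (∀ x ∈ cube n, f x ∈ Set.Icc (0:ℝ) 1) ∧
  (∀ y ∈ Set.Icc (0:ℝ) 1, ∃ x ∈ cube n, f x = y) ∧
  ContinuousOn f (cube n) ∧
  (∀ x ∈ cube n, ∀ y ∈ cube n, x ≤ y → f x ≤ f y)

/-- The vector `(x_{π<i}, c_{π≥i})`: coordinate `j` equals `x j` if `π j < π i`
and `c` otherwise. -/
def vecLT (n : ℕ) (π : Equiv.Perm (Fin n)) (i : Fin n) (x : Fin n → ℝ) (c : ℝ) :
    Fin n → ℝ := fun j => if π j < π i then x j else c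

/-- The vector `(x_{π≤i}, c_{π>i})`: coordinate `j` equals `x j` if `π j ≤ π i`
and `c` otherwise. -/
def vecLE (n : ℕ) (π : Equiv.Perm (Fin n)) (i : Fin n) (x : Fin n → ℝ) (c : ℝ) :
    Fin n → ℝ := fun j => if π j ≤ π i then x j else c

/-- The importance measure `φ` generalizing the Shapley-Shubik index. -/
def phi (n : ℕ) (f : (Fin n → ℝ) → ℝ) (i : Fin n) : ℝ :=
  (1 / (n.factorial : ℝ)) * ∑ π : Equiv.Perm (Fin n),
    ∫ x in cube n,
      ((f (vecLT n π i x 1) - f (vecLT n π i x 0)) -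
        (f (vecLE n π i x 1) - f (vecLE n π i x 0)))

theorem vecLT_mem_cube {n : ℕ} (π : Equiv.Perm (Fin n)) (i : Fin n) {x : Fin n → ℝ} {c : ℝ}
    (hx : x ∈ cube n) (hc : c ∈ Set.Icc (0 : ℝ) 1) : vecLT n π i x c ∈ cube n := by
  constructor <;> intro j <;> simp only [vecLT] <;> split_ifs
  exacts [hx.1 j, hc.1, hx.2 j, hc.2]

theorem vecLE_mem_cube {n : ℕ} (π : Equiv.Perm (Fin n)) (i : Fin n) {x : Fin n → ℝ} {c : ℝ}
    (hx : x ∈ cube n) (hc : c ∈ Set.Icc (0 : ℝ) 1) : vecLE n π i x c ∈ cube n := by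
  constructor <;> intro j <;> simp only [vecLE] <;> split_ifs
  exacts [hx.1 j, hc.1, hx.2 j, hc.2]

theorem volume_real_cube (n : ℕ) : volume.real (cube n) = 1 := by
  simp [cube, Measure.real, Real.volume_Icc_pi]

theorem zero_mem_cube (n : ℕ) : (0 : Fin n → ℝ) ∈ cube n := ⟨le_rfl, zero_le_one⟩

theorem one_mem_cube (n : ℕ) : (1 : Fin n → ℝ) ∈ cube n := ⟨zero_le_one, le_rfl⟩

theorem IsSimpleAgg.map_zero {n : ℕ} {f : (Fin n → ℝ) → ℝ} (hf : IsSimpleAgg n f) :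
    f 0 = 0 := by
  obtain ⟨hr, hs, -, hm⟩ := hf
  obtain ⟨x, hx, hfx⟩ := hs 0 (by simp)
  exact le_antisymm (hfx ▸ hm 0 (zero_mem_cube n) x hx hx.1) (hr 0 (zero_mem_cube n)).1

theorem IsSimpleAgg.map_one {n : ℕ} {f : (Fin n → ℝ) → ℝ} (hf : IsSimpleAgg n f) :
    f 1 = 1 := by
  obtain ⟨hr, hs, -, hm⟩ := hf
  obtain ⟨x, hx, hfx⟩ := hs 1 (by simp)
  exact le_antisymm (hr 1 (one_mem_cube n)).2 (hfx.symm.le.trans (hm x hx 1 (one_mem_cube n) hx.2))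

theorem phi_dictator (n : ℕ) (hn : 1 ≤ n) (f : (Fin n → ℝ) → ℝ)
    (hf : IsSimpleAgg n f) (i : Fin n)
    (hdict : ∀ x ∈ cube n, ∀ y ∈ cube n, x i = y i → f x = f y) :
    phi n f i = 1 := by
  have h0 : (0 : ℝ) ∈ Set.Icc (0 : ℝ) 1 := by simp
  have h1 : (1 : ℝ) ∈ Set.Icc (0 : ℝ) 1 := by simp
  have key : ∀ π : Equiv.Perm (Fin n), ∫ x in cube n,
      ((f (vecLT n π i x 1) - f (vecLT n π i x 0)) -
        (f (vecLE n π i x 1) - f (vecLE n π i x 0))) = 1 := by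
    intro π
    have hint : ∀ x ∈ cube n, ((f (vecLT n π i x 1) - f (vecLT n π i x 0)) -
        (f (vecLE n π i x 1) - f (vecLE n π i x 0))) = 1 := by
      intro x hx
      rw [hdict _ (vecLT_mem_cube π i hx h1) 1 (one_mem_cube n) (by simp [vecLT]),
        hdict _ (vecLT_mem_cube π i hx h0) 0 (zero_mem_cube n) (by simp [vecLT]),
        hdict _ (vecLE_mem_cube π i hx h1) x hx (by simp [vecLE]),
        hdict _ (vecLE_mem_cube π i hx h0) x hx (by simp [vecLE]), hf.map_one, hf.map_zero]
      norm_num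
    rw [setIntegral_congr_fun (s := cube n) measurableSet_Icc hint, setIntegral_const, volume_real_cube,
      smul_eq_mul, mul_one]
  have hfac : (n.factorial : ℝ) ≠ 0 := Nat.cast_ne_zero.mpr n.factorial_ne_zero
  simp only [phi, key]
  simp [Fintype.card_perm, hfac]
end
end

section
/- Let n ≥ 2, let f be a simple aggregation function on n agents, and let i, j ∈ {1,...,n} be symmetric agents in f. Then ψ̃_i(f) = ψ̃_j(f). -/
open MeasureTheory

noncomputable section

/-- The absolute importance measure `ψ̃` generalizing the Penrose-Banzhaf index. -/
def psiTilde (n : ℕ) (f : (Fin n → ℝ) → ℝ) (i : Fin n) : ℝ :=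
  ∫ x in cube n, (f (Function.update x i 1) - f (Function.update x i 0))

theorem comp_perm_mem_cube_iff {n : ℕ} (σ : Equiv.Perm (Fin n)) (x : Fin n → ℝ) :
    x ∘ σ ∈ cube n ↔ x ∈ cube n := by
  simp only [cube, Set.mem_Icc, Pi.le_def, Function.comp_apply, Pi.zero_apply, Pi.one_apply]
  exact and_congr (σ.forall_congr_left.trans (by simp)) (σ.forall_congr_left.trans (by simp))

theorem update_mem_cube {n : ℕ} {x : Fin n → ℝ} (hx : x ∈ cube n) (i : Fin n) {c : ℝ}
    (hc : c ∈ Set.Icc (0 : ℝ) 1) : Function.update x i c ∈ cube n :=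
  ⟨le_update_iff.2 ⟨hc.1, fun k _ => hx.1 k⟩,
    update_le_iff.2 ⟨hc.2, fun k _ => hx.2 k⟩⟩

theorem setIntegral_cube_comp_perm {n : ℕ} (σ : Equiv.Perm (Fin n)) (g : (Fin n → ℝ) → ℝ) :
    ∫ x in cube n, g (x ∘ σ) = ∫ x in cube n, g x := by
  have hcoe : ⇑(MeasurableEquiv.piCongrLeft (fun _ => ℝ) σ.symm) =
      fun x : Fin n → ℝ => x ∘ σ := by
    ext x k
    simpa using MeasurableEquiv.piCongrLeft_apply_apply (β := fun _ => ℝ) σ.symm x (σ k)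
  have h := (volume_measurePreserving_piCongrLeft (fun _ => ℝ) σ.symm).setIntegral_preimage_emb
    (MeasurableEquiv.measurableEmbedding _) g (cube n)
  rw [hcoe] at h
  have hpre : (fun x : Fin n → ℝ => x ∘ σ) ⁻¹' cube n = cube n :=
    Set.ext (comp_perm_mem_cube_iff σ)
  rwa [hpre] at h

theorem psiTilde_symmetric (n : ℕ) (hn : 2 ≤ n) (f : (Fin n → ℝ) → ℝ)
    (hf : IsSimpleAgg n f) (i j : Fin n)
    (hsym : ∀ x ∈ cube n, f (x ∘ Equiv.swap i j) = f x) :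
    psiTilde n f i = psiTilde n f j := by
  have key : ∀ x ∈ cube n, ∀ c ∈ Set.Icc (0 : ℝ) 1,
      f (Function.update (x ∘ Equiv.swap i j) j c) = f (Function.update x i c) := by
    intro x hx c hc
    rw [← hsym _ (update_mem_cube hx i hc), Function.update_comp_equiv, Equiv.symm_swap,
      Equiv.swap_apply_left]
  unfold psiTilde
  rw [← setIntegral_cube_comp_perm (Equiv.swap i j)
    (fun x => f (Function.update x j 1) - f (Function.update x j 0))]
  refine setIntegral_congr_fun measurableSet_Icc fun x hx => ?_
  simp only [key x hx 1 (by simp), key x hx 0 (by simp)]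
end
end
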